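/- (Reduction Theorem) Let n ≥ 10 and let C_1, …, C_{n−1} ∈ GL_r(ℂ) be an irreducible representation of B_n of dimension r with n+1 ≤ r ≤ 2n−9. Then there exist a nonzero complex number y, an integer k with 3 ≤ k ≤ r−n+2, and invertible matrices Ĉ_1, …, Ĉ_{n−1} ∈ GL_r(ℂ) forming an irreducible representation of B_n of dimension r with corank k (that is, rank(Ĉ_1 − I) = k), such that C_i = y·Ĉ_i for all i = 1, …, n−1. -/

import Mathlib

/-- braid relations for `g 0, …, g (n-2)` in a group -/
structure Br {Γ : Type*} [Group Γ] (n : ℕ) (g : ℕ → Γ) : Prop where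
  comm : ∀ i j, i + 2 ≤ j → j + 1 < n → g i * g j = g j * g i
  braid : ∀ i, i + 2 < n → g i * g (i + 1) * g i = g (i + 1) * g i * g (i + 1)

/-- cyclic extension of the braid generators -/
structure Cyc {Γ : Type*} [Group Γ] (n : ℕ) (e : ℕ → Γ) (δ : Γ) : Prop where
  conj : ∀ i, δ * e i = e (i + 1) * δ
  per : ∀ i, e (i + n) = e i
  comm : ∀ i m, 2 ≤ m → m + 2 ≤ n → e i * e (i + m) = e (i + m) * e i
  braid : ∀ i, e i * e (i + 1) * e i = e (i + 1) * e i * e (i + 1)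
  prod : ∀ i, δ = ((List.range (n - 1)).map fun j => e (i + j)).prod

section grp
variable {Γ : Type*} [Group Γ]

/-- the product of the first `k` generators -/
def pr (g : ℕ → Γ) (k : ℕ) : Γ := ((List.range k).map g).prod

lemma pr_succ (g : ℕ → Γ) (k : ℕ) : pr g (k + 1) = pr g k * g k := by
  simp [pr, List.range_succ]

lemma pr_succ' (g : ℕ → Γ) (k : ℕ) : pr g (k + 1) = g 0 * pr (fun j => g (j + 1)) k := by
  simp [pr, List.range_succ_eq_map, Function.comp_def]

lemma pr_congr (g h : ℕ → Γ) (k : ℕ) (H : ∀ i < k, g i = h i) : pr g k = pr h k := by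
  unfold pr
  congr 1
  apply List.map_congr_left
  intro a ha
  exact H a (List.mem_range.1 ha)

lemma pr_comm (g : ℕ → Γ) (x : Γ) (k : ℕ) (H : ∀ i < k, x * g i = g i * x) :
    x * pr g k = pr g k * x := by
  induction k with
  | zero => simp [pr]
  | succ k ih =>
    rw [pr_succ, ← mul_assoc, ih (fun i hi => H i (by omega)), mul_assoc, H k (by omega), mul_assoc]

lemma pr_conj (g : ℕ → Γ) (d : Γ) (h : ℕ → Γ) (k : ℕ) (H : ∀ i, d * g i = h i * d) :
    d * pr g k = pr h k * d := by
  induction k with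
  | zero => simp [pr]
  | succ k ih =>
    rw [pr_succ, pr_succ, ← mul_assoc, ih, mul_assoc, H k, mul_assoc]

lemma pr_shift {n : ℕ} {g : ℕ → Γ} (h : Br n g) (k : ℕ) (hk : k < n) (i : ℕ) (hi : i + 1 < k) :
    pr g k * g i = g (i + 1) * pr g k := by
  induction k with
  | zero => omega
  | succ k ih =>
    rcases Nat.lt_or_ge (i + 1) k with h1 | h1
    · rw [pr_succ, mul_assoc, ← h.comm i k (by omega) (by omega), ← mul_assoc,
        ih (by omega) h1, mul_assoc]
    · obtain rfl : k = i + 1 := by omega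
      have h2 := pr_comm g (g (i + 1)) i (fun j hj => (h.comm j (i + 1) (by omega) (by omega)).symm)
      rw [pr_succ, pr_succ]
      calc pr g i * g i * g (i + 1) * g i = pr g i * (g i * g (i + 1) * g i) := by
            simp only [mul_assoc]
        _ = pr g i * g (i + 1) * (g i * g (i + 1)) := by
            rw [h.braid i (by omega)]; simp only [mul_assoc]
        _ = _ := by rw [← h2]; simp only [mul_assoc]

theorem exists_cyc {n : ℕ} {g : ℕ → Γ} (h : Br n g) (hn : 3 ≤ n) :
    ∃ e δ, Cyc n e δ ∧ ∀ i < n - 1, e i = g i := by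
  set d := pr g (n - 1) with hd
  let e : ℕ → Γ := fun i => d ^ i * g 0 * (d ^ i)⁻¹
  have hconj : ∀ i, d * e i = e (i + 1) * d := by
    intro i
    simp only [e, pow_succ']
    group
  have hconj' : ∀ i, e (i + 1) = d * e i * d⁻¹ := by
    intro i; rw [hconj]; group
  have hg : ∀ i < n - 1, e i = g i := by
    intro i
    induction i with
    | zero => intro _; simp [e]
    | succ i ih =>
      intro hi
      rw [hconj', ih (by omega), hd, pr_shift h (n - 1) (by omega) i (by omega)]; group
  have hprod : ∀ i, d = pr (fun j => e (i + j)) (n - 1) := by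
    intro i
    induction i with
    | zero =>
      rw [hd]; apply pr_congr
      intro i hi; rw [zero_add, hg i hi]
    | succ i ih =>
      have := pr_conj (fun j => e (i + j)) d (fun j => e (i + 1 + j)) (n - 1)
        (fun j => by rw [hconj]; congr 2; omega)
      rw [← ih] at this
      exact mul_right_cancel this
  have hper0 : e n = e 0 := by
    have h0 := hprod 0
    have h1 := hprod 1
    obtain ⟨k, rfl⟩ : ∃ k, n = k + 2 := ⟨n - 2, by omega⟩
    rw [show k + 2 - 1 = k + 1 from rfl] at h0 h1
    rw [pr_succ'] at h0
    rw [pr_succ] at h1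
    have e1 : pr (fun j => e (0 + (j + 1))) k = pr (fun j => e (1 + j)) k :=
      pr_congr _ _ _ (fun i _ => by congr 1; omega)
    rw [e1] at h0
    rw [show k + 2 = (1 + k) + 1 by omega, hconj', mul_inv_eq_iff_eq_mul]
    calc d * e (1 + k) = e (0 + 0) * (pr (fun j => e (1 + j)) k * e (1 + k)) := by
          rw [← mul_assoc (e (0 + 0)), ← h0]
      _ = e 0 * d := by rw [← h1]
  have hper : ∀ i, e (i + n) = e i := by
    intro i
    induction i with
    | zero => rw [zero_add, hper0]
    | succ i ih => rw [show i + 1 + n = i + n + 1 by omega, hconj', ih, ← hconj']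
  refine ⟨e, d, ⟨hconj, hper, ?_, ?_, hprod⟩, hg⟩
  · intro i m h2 hm
    induction i with
    | zero => rw [hg 0 (by omega), zero_add, hg m (by omega), h.comm 0 m (by omega) (by omega)]
    | succ i ih =>
      rw [show i + 1 + m = i + m + 1 by omega, hconj' i, hconj' (i + m)]
      calc d * e i * d⁻¹ * (d * e (i + m) * d⁻¹) = d * (e i * e (i + m)) * d⁻¹ := by group
        _ = d * (e (i + m) * e i) * d⁻¹ := by rw [ih]
        _ = _ := by group
  · intro i
    induction i with
    | zero => rw [hg 0 (by omega), hg (0 + 1) (by omega), h.braid 0 (by omega)]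
    | succ i ih =>
      rw [hconj' (i + 1), hconj' i]
      rw [hconj' i] at ih
      calc d * e i * d⁻¹ * (d * (d * e i * d⁻¹) * d⁻¹) * (d * e i * d⁻¹)
          = d * (e i * (d * e i * d⁻¹) * e i) * d⁻¹ := by group
        _ = d * ((d * e i * d⁻¹) * e i * (d * e i * d⁻¹)) * d⁻¹ := by rw [ih]
        _ = _ := by group

lemma Cyc.all_eq {n : ℕ} {e : ℕ → Γ} {δ : Γ} (h : Cyc n e δ) (k : ℕ) (hk : e k = e (k + 1)) :
    ∀ i, e i = e 0 := by
  have h0 : ∀ k, e k = e (k + 1) → e 0 = e 1 := by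
    intro k
    induction k with
    | zero => exact id
    | succ k ih =>
      intro h1
      apply ih
      have a := h.conj k
      have b := h.conj (k + 1)
      rw [← h1, ← a] at b
      exact (mul_left_cancel b).symm
  have h1 := h0 k hk
  have h2 : ∀ i, e i = e (i + 1) := by
    intro i
    induction i with
    | zero => exact h1
    | succ i ih =>
      have a := h.conj i
      have b := h.conj (i + 1)
      rw [← ih, a] at b
      exact mul_right_cancel b
  intro i
  induction i with
  | zero => rfl
  | succ i ih => rw [← h2, ih]
end grp

section lin
open Module

/-- all generators coincide -/
def AllEq {Γ : Type*} (n : ℕ) (g : ℕ → Γ) : Prop := ∀ i < n - 1, g i = g 0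

lemma Br.ab {Γ : Type*} [Group Γ] {n : ℕ} {g : ℕ → Γ} (h : Br n g) (hn : 3 ≤ n) (k : ℕ)
    (hk : k + 1 < n - 1) (he : g k = g (k + 1)) : AllEq n g := by
  obtain ⟨e, δ, hc, hg⟩ := exists_cyc h hn
  have := hc.all_eq k (by rw [hg k (by omega), hg (k + 1) hk, he])
  intro i hi
  rw [← hg i hi, this, hg 0 (by omega)]

lemma Br.eq_of_comm {Γ : Type*} [Group Γ] {n : ℕ} {g : ℕ → Γ} (h : Br n g) (hn : 3 ≤ n)
    (hc : g 0 * g 1 = g 1 * g 0) : AllEq n g := by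
  apply h.ab hn 0 (by omega)
  have hb := h.braid 0 (by omega)
  rw [zero_add] at *
  rw [← hc, mul_assoc, mul_assoc, ← hc] at hb
  have := mul_left_cancel hb
  rw [hc] at this
  exact mul_left_cancel this

set_option linter.unusedSectionVars false
variable {V : Type} [AddCommGroup V] [Module ℂ V] [FiniteDimensional ℂ V]

lemma Br.ext_ab {n : ℕ} {g : ℕ → (End ℂ V)ˣ} (h : Br n g) (hn : 5 ≤ n)
    (h1 : ∀ x, (g 1 : End ℂ V) ((g 3 : End ℂ V) x - (g 0 : End ℂ V) x) =
      (g 0 : End ℂ V) ((g 3 : End ℂ V) x - (g 0 : End ℂ V) x))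
    (h2 : ∀ x, (g 3 : End ℂ V) ((g 1 : End ℂ V) x - (g 0 : End ℂ V) x) =
      (g 0 : End ℂ V) ((g 1 : End ℂ V) x - (g 0 : End ℂ V) x)) : AllEq n g := by
  apply h.eq_of_comm (by omega)
  ext x
  have c1 := congrArg (fun u : (End ℂ V)ˣ => (u : End ℂ V) x) (h.comm 1 3 (by omega) (by omega))
  have c2 := congrArg (fun u : (End ℂ V)ˣ => (u : End ℂ V) x) (h.comm 0 3 (by omega) (by omega))
  have a := h1 x
  have b := h2 x
  simp only [Units.val_mul, Module.End.mul_apply, map_sub] at *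
  have e1 := sub_eq_zero.2 c1
  have e2 := sub_eq_zero.2 c2
  have e3 := sub_eq_zero.2 a
  have e4 := sub_eq_zero.2 b
  rw [← sub_eq_zero]
  have e5 := congrArg₂ (· - ·) (congrArg₂ (· - ·) e3 e4) (congrArg₂ (· - ·) e1 e2)
  simp only [sub_zero] at e5
  rw [← e5]
  abel

lemma Br.restrict {n : ℕ} {g : ℕ → (End ℂ V)ˣ} (h : Br n g) (W : Submodule ℂ V)
    (hW : ∀ i < n - 1, ∀ x ∈ W, (g i : End ℂ V) x ∈ W) :
    ∃ w : ℕ → (End ℂ W)ˣ, Br n w ∧ ∀ i < n - 1, ∀ x : W,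
      ((w i : End ℂ W) x : V) = (g i : End ℂ V) x := by
  have : ∀ i, ∃ u : (End ℂ W)ˣ, i < n - 1 → ∀ x : W,
      ((u : End ℂ W) x : V) = (g i : End ℂ V) x := by
    intro i
    by_cases hi : i < n - 1
    · have hu : IsUnit ((g i : End ℂ V).restrict (hW i hi)) := by
        rw [LinearMap.isUnit_iff_ker_eq_bot, LinearMap.ker_eq_bot]
        intro x y hxy
        have h1 := congrArg (fun z : W => (z : V)) hxy
        simp only [LinearMap.coe_restrict_apply] at h1
        have h2 : Function.Injective (g i : End ℂ V) := by
          rw [← LinearMap.ker_eq_bot, ← LinearMap.isUnit_iff_ker_eq_bot]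
          exact (g i).isUnit
        exact Subtype.ext (h2 h1)
      exact ⟨hu.unit, fun _ x => by simp⟩
    · exact ⟨1, fun h => absurd h hi⟩
  choose w hw using this
  refine ⟨w, ⟨?_, ?_⟩, hw⟩
  · intro i j hij hj
    ext x
    have c := congrArg (fun u : (End ℂ V)ˣ => (u : End ℂ V) x) (h.comm i j hij hj)
    simp only [Units.val_mul, Module.End.mul_apply] at *
    rw [hw i (by omega), hw j (by omega), hw j (by omega), hw i (by omega), c]
  · intro i hi
    ext x
    have c := congrArg (fun u : (End ℂ V)ˣ => (u : End ℂ V) x) (h.braid i hi)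
    simp only [Units.val_mul, Module.End.mul_apply] at *
    simp only [hw i (by omega), hw (i + 1) (by omega), c]

/-- extension argument on an invariant subspace `K` with a commuting operator `T` -/
lemma Br.split {n : ℕ} {g : ℕ → (End ℂ V)ˣ} (h : Br n g) (hn : 5 ≤ n) (T : End ℂ V)
    (K : Submodule ℂ V) (hK : ∀ i < n - 1, ∀ x ∈ K, (g i : End ℂ V) x ∈ K)
    (hT : ∀ i < n - 1, ∀ x, T ((g i : End ℂ V) x) = (g i : End ℂ V) (T x))
    (h1 : ∀ x ∈ K, T x = 0 → ∀ i < n - 1, (g i : End ℂ V) x = (g 0 : End ℂ V) x)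
    (h2 : ∀ x ∈ K, ∀ i < n - 1, (g i : End ℂ V) (T x) = (g 0 : End ℂ V) (T x)) :
    ∀ x ∈ K, ∀ i < n - 1, (g i : End ℂ V) x = (g 0 : End ℂ V) x := by
  obtain ⟨w, hw, hwg⟩ := h.restrict K hK
  have key : AllEq n w := by
    apply hw.ext_ab hn
    · intro x
      apply Subtype.ext
      rw [hwg 1 (by omega), hwg 0 (by omega)]
      refine h1 _ (Subtype.mem _) ?_ 1 (by omega)
      rw [Submodule.coe_sub, hwg 3 (by omega), hwg 0 (by omega), map_sub, hT 3 (by omega),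
        hT 0 (by omega), h2 x x.2 3 (by omega), sub_self]
    · intro x
      apply Subtype.ext
      rw [hwg 3 (by omega), hwg 0 (by omega)]
      refine h1 _ (Subtype.mem _) ?_ 3 (by omega)
      rw [Submodule.coe_sub, hwg 1 (by omega), hwg 0 (by omega), map_sub, hT 1 (by omega),
        hT 0 (by omega), h2 x x.2 1 (by omega), sub_self]
  intro x hx i hi
  have := hwg i hi ⟨x, hx⟩
  rw [key i hi, hwg 0 (by omega)] at this
  exact this.symm

/-- every representation of `B_m` of dimension at most `d` has equal generators -/
def PP (m d : ℕ) : Prop := ∀ (V : Type) [AddCommGroup V] [Module ℂ V] [FiniteDimensional ℂ V]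
  (g : ℕ → (End ℂ V)ˣ), Br m g → finrank ℂ V ≤ d → AllEq m g

lemma Br.ab_on {n : ℕ} {g : ℕ → (End ℂ V)ˣ} (h : Br n g) (W : Submodule ℂ V)
    (hW : ∀ i < n - 1, ∀ x ∈ W, (g i : End ℂ V) x ∈ W)
    (hP : ∀ w : ℕ → (End ℂ W)ˣ, Br n w → AllEq n w) :
    ∀ x ∈ W, ∀ i < n - 1, (g i : End ℂ V) x = (g 0 : End ℂ V) x := by
  obtain ⟨w, hw, hwg⟩ := h.restrict W hW
  intro x hx i hi
  have := hwg i hi ⟨x, hx⟩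
  rw [hP w hw i hi, hwg 0 (by omega)] at this
  exact this.symm

lemma PP_one (n : ℕ) (hn : 3 ≤ n) : PP n 1 := by
  intro V _ _ _ g h hd
  apply h.eq_of_comm hn
  obtain ⟨v, hv⟩ := finrank_le_one_iff.1 hd
  ext x
  obtain ⟨a, ha⟩ := hv ((g 0 : End ℂ V) v)
  obtain ⟨b, hb⟩ := hv ((g 1 : End ℂ V) v)
  obtain ⟨c, rfl⟩ := hv x
  simp only [Units.val_mul, Module.End.mul_apply, map_smul, ← ha, ← hb, smul_comm a b]

/-- polynomial kernel list -/
lemma exists_list (C : End ℂ V) : ∃ s : List ℂ, (s.map fun a => C - algebraMap ℂ (End ℂ V) a).prod = 0 := by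
  have h1 := LinearMap.aeval_self_charpoly C
  have h2 := (IsAlgClosed.splits C.charpoly).eq_prod_roots_of_monic (LinearMap.charpoly_monic C)
  refine ⟨C.charpoly.roots.toList, ?_⟩
  rw [h2] at h1
  rw [← Multiset.coe_toList C.charpoly.roots, Multiset.map_coe, Multiset.prod_coe, map_list_prod,
    List.map_map] at h1
  simpa [Function.comp_def] using h1

lemma dichotomy {n d : ℕ} (hn : 7 ≤ n) (hP : PP (n - 2) d) (hV : finrank ℂ V ≤ 2 * d + 1)
    {g : ℕ → (End ℂ V)ˣ} (h : Br n g) : AllEq n g ∨ ∃ y : ℂ, y ≠ 0 ∧ ∀ i, i + 2 < n - 1 → 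
      ((g (i + 2) : End ℂ V) - (g 2 : End ℂ V)) * ((g 0 : End ℂ V) - algebraMap ℂ (End ℂ V) y) = 0 := by
  by_cases hy : ∃ y : ℂ, ∀ i, i + 2 < n - 1 → 
      ((g (i + 2) : End ℂ V) - (g 2 : End ℂ V)) * ((g 0 : End ℂ V) - algebraMap ℂ (End ℂ V) y) = 0
  · obtain ⟨y, hy⟩ := hy
    by_cases hy0 : y = 0
    · left
      subst hy0
      have := hy 1 (by omega)
      rw [map_zero, sub_zero, Units.mul_left_eq_zero, sub_eq_zero] at this
      exact h.ab (by omega) 2 (by omega) (Units.ext this.symm)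
    · exact Or.inr ⟨y, hy0, hy⟩
  left
  let g' : ℕ → (End ℂ V)ˣ := fun i => g (i + 2)
  have hg' : Br (n - 2) g' := by
    constructor
    · intro i j hij hj
      exact h.comm (i + 2) (j + 2) (by omega) (by omega)
    · intro i hi
      exact h.braid (i + 2) (by omega)
  have hcomm : ∀ i < n - 2 - 1, (g' i : End ℂ V) * (g 0 : End ℂ V) = (g 0 : End ℂ V) * (g' i : End ℂ V) := by
    intro i hi
    have := h.comm 0 (i + 2) (by omega) (by omega)
    exact_mod_cast this.symm
  have hcommT : ∀ (y : ℂ), ∀ i < n - 2 - 1, Commute (g' i : End ℂ V)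
      ((g 0 : End ℂ V) - algebraMap ℂ (End ℂ V) y) := by
    intro y i hi
    exact Commute.sub_right (hcomm i hi) (Algebra.commutes y _).symm
  have hker : ∀ y : ℂ, ∀ x, ((g 0 : End ℂ V) - algebraMap ℂ (End ℂ V) y) x = 0 →
      ∀ i < n - 2 - 1, (g' i : End ℂ V) x = (g' 0 : End ℂ V) x := by
    intro y
    set T := (g 0 : End ℂ V) - algebraMap ℂ (End ℂ V) y with hT
    have hTc : ∀ i < n - 2 - 1, ∀ x, T ((g' i : End ℂ V) x) = (g' i : End ℂ V) (T x) := by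
      intro i hi x
      have := congrArg (fun f : End ℂ V => f x) (hcommT y i hi).eq
      exact this.symm
    have hrk := LinearMap.finrank_range_add_finrank_ker T
    by_cases hr : finrank ℂ (LinearMap.range T) ≤ d
    · exfalso
      apply hy
      refine ⟨y, fun i hi => ?_⟩
      ext x
      have := hg'.ab_on (LinearMap.range T) (by
        rintro j hj _ ⟨x, rfl⟩
        exact ⟨(g' j : End ℂ V) x, hTc j hj x⟩) (fun w hw => hP _ w hw hr) (T x) ⟨x, rfl⟩ i (by omega)
      simp only [Module.End.mul_apply, LinearMap.sub_apply, LinearMap.zero_apply, sub_eq_zero]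
      exact this
    · intro x hx
      exact hg'.ab_on (LinearMap.ker T) (by
        intro j hj x hx
        rw [LinearMap.mem_ker] at *
        rw [hTc j hj, hx, map_zero]) (fun w hw => hP _ w hw (by omega)) x hx
  have hlist : ∀ s : List ℂ, ∀ x, (s.map fun a => (g 0 : End ℂ V) - algebraMap ℂ (End ℂ V) a).prod x = 0 →
      ∀ i < n - 2 - 1, (g' i : End ℂ V) x = (g' 0 : End ℂ V) x := by
    intro s
    induction s with
    | nil => intro x hx; simp at hx; subst hx; simp
    | cons a s ih =>
      set S := (s.map fun a => (g 0 : End ℂ V) - algebraMap ℂ (End ℂ V) a).prod with hS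
      have hSc : ∀ i < n - 2 - 1, Commute (g' i : End ℂ V) S := by
        intro i hi
        apply Commute.list_prod_right
        intro x hx
        simp only [List.mem_map] at hx
        obtain ⟨b, _, rfl⟩ := hx
        exact hcommT b i hi
      have hSc' : ∀ i < n - 2 - 1, ∀ x, S ((g' i : End ℂ V) x) = (g' i : End ℂ V) (S x) := by
        intro i hi x
        have := congrArg (fun f : End ℂ V => f x) (hSc i hi).eq
        exact this.symm
      have hQ : ∀ i < n - 2 - 1, ∀ x, ((g 0 : End ℂ V) - algebraMap ℂ (End ℂ V) a) ((g' i : End ℂ V) x)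
         = (g' i : End ℂ V) (((g 0 : End ℂ V) - algebraMap ℂ (End ℂ V) a) x) := by
        intro i hi x
        have := congrArg (fun f : End ℂ V => f x) (hcommT a i hi).eq
        exact this.symm
      rw [List.map_cons, List.prod_cons, ← hS]
      intro x hx
      refine hg'.split (by omega) S
        (LinearMap.ker (((g 0 : End ℂ V) - algebraMap ℂ (End ℂ V) a) * S)) ?_ hSc' ?_ ?_ x hx
      · intro i hi x hx
        rw [LinearMap.mem_ker, Module.End.mul_apply] at *
        rw [hSc' i hi, hQ i hi, hx, map_zero]
      · intro x _ hx
        exact ih x hx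
      · intro x hx
        exact hker a (S x) hx
  obtain ⟨s, hs⟩ := exists_list (g 0 : End ℂ V)
  refine h.ab (by omega) 2 (by omega) ?_
  ext x
  exact (hlist s x (by rw [hs]; rfl) 1 (by omega)).symm
end lin

section core
open Module
set_option linter.unusedSectionVars false
set_option linter.unusedVariables false
variable {V : Type} [AddCommGroup V] [Module ℂ V] [FiniteDimensional ℂ V]

/-- `A i = e i - 1` -/
def AA (e : ℕ → (End ℂ V)ˣ) (i : ℕ) : End ℂ V := (e i : End ℂ V) - 1

variable {n : ℕ} {e : ℕ → (End ℂ V)ˣ} {δ : (End ℂ V)ˣ}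

lemma Cyc.A_conj (h : Cyc n e δ) (i : ℕ) : (δ : End ℂ V) * AA e i = AA e (i + 1) * δ := by
  have : (δ : End ℂ V) * (e i : End ℂ V) = (e (i + 1) : End ℂ V) * δ := by exact_mod_cast h.conj i
  simp only [AA, mul_sub, sub_mul, this, mul_one, one_mul]

lemma Cyc.A_conj2 (h : Cyc n e δ) (i j : ℕ) :
    (δ : End ℂ V) * (AA e i * AA e j) = AA e (i + 1) * AA e (j + 1) * δ := by
  rw [← mul_assoc, h.A_conj, mul_assoc, h.A_conj, mul_assoc]

lemma Cyc.A_comm (h : Cyc n e δ) (i m : ℕ) (h2 : 2 ≤ m) (hm : m + 2 ≤ n) :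
    AA e i * AA e (i + m) = AA e (i + m) * AA e i := by
  have : (e i : End ℂ V) * (e (i + m) : End ℂ V) = (e (i + m) : End ℂ V) * (e i : End ℂ V) := by
    exact_mod_cast h.comm i m h2 hm
  simp only [AA, mul_sub, sub_mul, this, mul_one, one_mul]
  abel

lemma Cyc.A_per (h : Cyc n e δ) (i : ℕ) : AA e (i + n) = AA e i := by
  simp only [AA, h.per]

lemma Cyc.A_braid (h : Cyc n e δ) (i : ℕ) :
    AA e i * e i + AA e i * AA e (i + 1) * AA e i =
      AA e (i + 1) * e (i + 1) + AA e (i + 1) * AA e i * AA e (i + 1) := by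
  have : (e i : End ℂ V) * (e (i + 1) : End ℂ V) * (e i : End ℂ V)
      = (e (i + 1) : End ℂ V) * (e i : End ℂ V) * (e (i + 1) : End ℂ V) := by
    exact_mod_cast h.braid i
  have h3 := sub_eq_zero.2 this
  rw [← sub_eq_zero, ← h3]
  simp only [AA]
  noncomm_ring

lemma Cyc.exists_N (h : Cyc n e δ) (hn : 6 ≤ n)
    (H : ∀ m, 2 ≤ m → m + 2 ≤ n → AA e m * AA e 0 = AA e 2 * AA e 0) :
    ∃ N : End ℂ V, (∀ k, N * e k = e k * N) ∧
      ∀ i m, 2 ≤ m → m + 2 ≤ n → AA e (i + m) * AA e i = N := by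
  have H1 : ∀ i m, 2 ≤ m → m + 2 ≤ n → AA e (i + m) * AA e i = AA e (i + 2) * AA e i := by
    intro i m h2 hm
    induction i with
    | zero => rw [zero_add, zero_add, H m h2 hm]
    | succ i ih =>
      have a := h.A_conj2 (i + m) i
      have b := h.A_conj2 (i + 2) i
      rw [ih, b] at a
      have := (Units.mul_left_inj δ).1 a
      rw [show i + 1 + m = i + m + 1 by omega, show i + 1 + 2 = i + 2 + 1 by omega, this]
  have H2 : ∀ i m, 2 ≤ m → m + 2 ≤ n → AA e (i + m + 2) * AA e (i + m) = AA e (i + 2) * AA e i := by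
    intro i m h2 hm
    have a := H1 (i + m) (n - m) (by omega) (by omega)
    rw [show i + m + (n - m) = i + n by omega, h.A_per, h.A_comm i m h2 hm, H1 i m h2 hm] at a
    exact a.symm
  have H3 : ∀ i, AA e (i + 2) * AA e i = AA e 2 * AA e 0 := by
    intro i
    induction i with
    | zero => simp
    | succ i ih =>
      have a := H2 (i + 1) 2 (by omega) (by omega)
      have b := H2 i 3 (by omega) (by omega)
      rw [show i + 1 + 2 = i + 3 by omega] at a ⊢
      rw [← ih, ← b, ← a]
  have H4 : ∀ i m, 2 ≤ m → m + 2 ≤ n → AA e (i + m) * AA e i = AA e 2 * AA e 0 :=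
    fun i m h2 hm => by rw [H1 i m h2 hm, H3]
  refine ⟨AA e 2 * AA e 0, ?_, H4⟩
  intro k
  rw [← H3 (k + 2)]
  have c1 : (e k : End ℂ V) * (e (k + 2) : End ℂ V) = (e (k + 2) : End ℂ V) * (e k : End ℂ V) := by
    exact_mod_cast h.comm k 2 (by omega) (by omega)
  have c2 : (e k : End ℂ V) * (e (k + 2 + 2) : End ℂ V) = (e (k + 2 + 2) : End ℂ V) * (e k : End ℂ V) := by
    exact_mod_cast h.comm k 4 (by omega) (by omega)
  have d1 : Commute (e k : End ℂ V) (AA e (k + 2)) := Commute.sub_right c1 (Commute.one_right _)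
  have d2 : Commute (e k : End ℂ V) (AA e (k + 2 + 2)) := Commute.sub_right c2 (Commute.one_right _)
  exact (d2.mul_right d1).eq.symm

/-- if `N` is a scalar then it vanishes unless all generators coincide -/
lemma Cyc.N_scalar (h : Cyc n e δ) (hn : 6 ≤ n) (c : ℂ)
    (H : ∀ i m, 2 ≤ m → m + 2 ≤ n → AA e (i + m) * AA e i = algebraMap ℂ (End ℂ V) c) :
    c = 0 ∨ e 2 = e 3 := by
  by_cases hc : c = 0
  · exact Or.inl hc
  right
  have h1 := H 0 2 (by omega) (by omega)
  have h2 := H 0 3 (by omega) (by omega)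
  have h3 := h.A_comm 0 2 (by omega) (by omega)
  rw [zero_add] at *
  have h4 : (AA e 3 - AA e 2) * (AA e 0 * AA e 2) = 0 := by
    rw [← mul_assoc, sub_mul, h1, h2, sub_self, zero_mul]
  rw [h3, h1, ← Algebra.commutes, ← Algebra.smul_def, smul_eq_zero] at h4
  have h5 := h4.resolve_left hc
  apply Units.ext
  simp only [AA] at h5
  have : (e 3 : End ℂ V) - e 2 = 0 := by rw [← h5]; abel
  exact (sub_eq_zero.1 this).symm

lemma Cyc.dim_ge (h : Cyc n e δ) (hn : 3 ≤ n) (hV : finrank ℂ V + 3 ≤ n)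
    (H : ∀ i m, 2 ≤ m → m + 2 ≤ n → AA e (i + m) * AA e i = 0) : e 0 = e 1 := by
  by_contra hne
  have hnz : ∀ i, AA e (i + 1) * AA e i ≠ 0 := by
    intro i
    induction i with
    | zero =>
      intro h0
      apply hne
      have hb := h.A_braid 0
      rw [zero_add] at *
      have e1 : AA e 0 * AA e 1 * AA e 0 = 0 := by rw [mul_assoc, h0, mul_zero]
      have e2 : AA e 1 * AA e 0 * AA e 1 = 0 := by rw [h0, zero_mul]
      rw [e1, e2, add_zero, add_zero] at hb
      have e3 : AA e 1 * AA e 1 * (e 1 : End ℂ V) = 0 := by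
        rw [mul_assoc, ← hb, ← mul_assoc, h0, zero_mul]
      have e4 : AA e 1 * AA e 1 = 0 := (Units.mul_left_eq_zero _).1 e3
      have e5 := h.A_conj2 0 0
      rw [zero_add, e4, zero_mul] at e5
      have e6 := (Units.mul_right_eq_zero δ).1 e5
      have f : ∀ i, AA e i * (e i : End ℂ V) = AA e i * AA e i + AA e i := by
        intro i; simp only [AA]; noncomm_ring
      rw [f, f, e4, e6, zero_add, zero_add] at hb
      exact Units.ext (sub_left_injective hb)
    | succ i ih =>
      intro h0
      apply ih
      have a := h.A_conj2 (i + 1) i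
      rw [h0, zero_mul] at a
      exact (Units.mul_right_eq_zero δ).1 a
  have key : ∀ k, k + 3 ≤ n → ∃ S : Submodule ℂ V, k + 1 ≤ finrank ℂ S ∧
      ∀ j, k + 2 ≤ j → j + 2 ≤ n → ∀ x ∈ S, AA e j x = 0 := by
    intro k
    induction k with
    | zero =>
      intro _
      refine ⟨LinearMap.range (AA e 0), ?_, ?_⟩
      · rw [Nat.succ_le_iff, Nat.pos_iff_ne_zero, Ne, Submodule.finrank_eq_zero,
          LinearMap.range_eq_bot]
        intro h0
        exact hnz 0 (by rw [h0, mul_zero])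
      · rintro j h2 hj _ ⟨x, rfl⟩
        have := H 0 j (by omega) hj
        rw [zero_add] at this
        rw [← Module.End.mul_apply, this]; rfl
    | succ k ih =>
      intro hk
      obtain ⟨S, hS, hS2⟩ := ih (by omega)
      refine ⟨S ⊔ LinearMap.range (AA e (k + 1)), ?_, ?_⟩
      · have hlt : S < S ⊔ LinearMap.range (AA e (k + 1)) := by
          rw [left_lt_sup]
          intro hle
          apply hnz (k + 1)
          ext x
          exact hS2 (k + 1 + 1) (by omega) (by omega) _ (hle ⟨x, rfl⟩)
        have := Submodule.finrank_lt_finrank_of_lt hlt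
        omega
      · intro j h2 hj x hx
        obtain ⟨a, ha, b, ⟨c, rfl⟩, rfl⟩ := Submodule.mem_sup.1 hx
        have := H (k + 1) (j - (k + 1)) (by omega) (by omega)
        rw [show k + 1 + (j - (k + 1)) = j by omega] at this
        rw [map_add, hS2 j (by omega) hj a ha, ← Module.End.mul_apply, this, zero_add]; rfl
  obtain ⟨S, hS, _⟩ := key (n - 3) (by omega)
  have := Submodule.finrank_le S
  omega

/-- rescaling -/
lemma Br.scale {g : ℕ → (End ℂ V)ˣ} (h : Br n g) (y : ℂ) (hy : y ≠ 0) (hn : 6 ≤ n)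
    (H : ∀ i, i + 2 < n - 1 → 
      ((g (i + 2) : End ℂ V) - (g 2 : End ℂ V)) * ((g 0 : End ℂ V) - algebraMap ℂ (End ℂ V) y) = 0) :
    ∃ (e : ℕ → (End ℂ V)ˣ) (δ : (End ℂ V)ˣ), Cyc n e δ ∧ (∀ i < n - 1, (g i : End ℂ V) = y • (e i : End ℂ V)) ∧
      ∃ N : End ℂ V, (∀ k, N * e k = e k * N) ∧
      ∀ i m, 2 ≤ m → m + 2 ≤ n → AA e (i + m) * AA e i = N := by
  let u : (End ℂ V)ˣ := Units.map (algebraMap ℂ (End ℂ V)).toMonoidHom (Units.mk0 y hy)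
  have hu : (u : End ℂ V) = algebraMap ℂ (End ℂ V) y := rfl
  have hc : ∀ x : (End ℂ V)ˣ, u * x = x * u := by
    intro x; ext1; simp only [Units.val_mul, hu, Algebra.commutes]
  have hc' : ∀ x : (End ℂ V)ˣ, u⁻¹ * x = x * u⁻¹ := by
    intro x; rw [inv_mul_eq_iff_eq_mul, ← mul_assoc, hc, mul_assoc, mul_inv_cancel, mul_one]
  have hm : ∀ x y : (End ℂ V)ˣ, u⁻¹ * x * (u⁻¹ * y) = u⁻¹ * u⁻¹ * (x * y) := by
    intro x y
    rw [mul_assoc, ← mul_assoc x, ← hc' x]; simp only [mul_assoc]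
  have hb : Br n (fun i => u⁻¹ * g i) := by
    constructor
    · intro i j hij hj
      simp only [hm, h.comm i j hij hj]
    · intro i hi
      have hm3 : ∀ x y z : (End ℂ V)ˣ, u⁻¹ * x * (u⁻¹ * y) * (u⁻¹ * z) =
          u⁻¹ * u⁻¹ * u⁻¹ * (x * y * z) := by
        intro x y z
        rw [hm, mul_assoc (u⁻¹ * u⁻¹), ← mul_assoc (x * y), ← hc' (x * y)]; simp only [mul_assoc]
      simp only [hm3, h.braid i hi]
  obtain ⟨e, δ, he, heg⟩ := exists_cyc hb (by omega)
  have hge : ∀ i < n - 1, (g i : End ℂ V) = y • (e i : End ℂ V) := by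
    intro i hi
    rw [heg i hi, Algebra.smul_def, ← hu, ← Units.val_mul, mul_inv_cancel_left]
  refine ⟨e, δ, he, hge, he.exists_N hn ?_⟩
  intro m h2 hm
  have a := H (m - 2) (by omega)
  rw [show m - 2 + 2 = m by omega, hge m (by omega), hge 2 (by omega), hge 0 (by omega),
    Algebra.algebraMap_eq_smul_one, ← smul_sub, ← smul_sub, smul_mul_smul_comm, smul_eq_zero] at a
  have b := a.resolve_left (mul_ne_zero hy hy)
  rw [← sub_eq_zero, ← sub_mul, ← b]
  simp only [AA, sub_sub_sub_cancel_right]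

lemma allEq_of_scale {g : ℕ → (End ℂ V)ˣ} (hn : 6 ≤ n) (he : Cyc n e δ) (y : ℂ)
    (hge : ∀ i < n - 1, (g i : End ℂ V) = y • (e i : End ℂ V)) (k : ℕ) (hk : e k = e (k + 1)) :
    AllEq n g := by
  intro i hi
  ext1
  rw [hge i hi, hge 0 (by omega), he.all_eq k hk]

lemma core_ab (hn : 6 ≤ n) (d : ℕ) (hd : d + 3 ≤ n) : ∀ (k : ℕ), k ≤ d →
    (∀ (V : Type) [AddCommGroup V] [Module ℂ V] [FiniteDimensional ℂ V]
      (g : ℕ → (End ℂ V)ˣ), Br n g → finrank ℂ V ≤ d → AllEq n g ∨ ∃ y : ℂ, y ≠ 0 ∧ ∀ i, i + 2 < n - 1 → 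
      ((g (i + 2) : End ℂ V) - (g 2 : End ℂ V)) * ((g 0 : End ℂ V) - algebraMap ℂ (End ℂ V) y) = 0) →
    PP n k := by
  intro k
  induction k using Nat.strong_induction_on with
  | _ k ih =>
  intro hk HH V _ _ _ g hg hV
  by_cases htriv : Subsingleton V
  · intro i _
    ext x
    exact Subsingleton.elim _ _
  have hnt : Nontrivial V := not_subsingleton_iff_nontrivial.1 htriv
  rcases HH V g hg (by omega) with h | ⟨y, hy, H⟩
  · exact h
  obtain ⟨e, δ, he, hge, N, hN1, hN2⟩ := hg.scale y hy hn H
  obtain ⟨c, hc⟩ := Module.End.exists_eigenvalue N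
  set T := N - algebraMap ℂ (End ℂ V) c with hT
  have hker : LinearMap.ker T ≠ ⊥ := by
    rw [Module.End.hasEigenvalue_iff, Module.End.eigenspace_def] at hc
    exact hc
  by_cases hT0 : T = 0
  · rw [hT, sub_eq_zero] at hT0
    subst hT0
    rcases he.N_scalar hn c hN2 with h0 | h0
    · subst h0
      rw [map_zero] at hN2
      exact allEq_of_scale hn he y hge 0 (he.dim_ge (by omega) (by omega) hN2)
    · exact allEq_of_scale hn he y hge 2 h0
  · have hTg : ∀ i < n - 1, ∀ x, T ((g i : End ℂ V) x) = (g i : End ℂ V) (T x) := by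
      intro i hi x
      rw [hge i hi]
      have h1 : Commute N (e i : End ℂ V) := hN1 i
      have h2 : Commute T (e i : End ℂ V) := Commute.sub_left h1 (Algebra.commutes c _)
      have := congrArg (fun f : End ℂ V => f x) h2.eq
      simp only [Module.End.mul_apply] at this
      rw [LinearMap.smul_apply, LinearMap.smul_apply, map_smul, this]
    have hrk := LinearMap.finrank_range_add_finrank_ker T
    have hk1 : 0 < finrank ℂ (LinearMap.ker T) := by
      rw [Nat.pos_iff_ne_zero, Ne, Submodule.finrank_eq_zero]; exact hker
    have hk2 : 0 < finrank ℂ (LinearMap.range T) := by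
      rw [Nat.pos_iff_ne_zero, Ne, Submodule.finrank_eq_zero, LinearMap.range_eq_bot]; exact hT0
    have := hg.split (by omega) T ⊤ (fun _ _ _ _ => trivial) hTg
      (fun x _ hx => hg.ab_on (LinearMap.ker T) (by
        intro j hj x hx
        rw [LinearMap.mem_ker] at *
        rw [hTg j hj, hx, map_zero])
        (fun w hw => ih (finrank ℂ (LinearMap.ker T)) (by omega) (by omega) HH _ w hw le_rfl) x hx)
      (fun x _ => hg.ab_on (LinearMap.range T) (by
        rintro j hj _ ⟨x, rfl⟩
        exact ⟨(g j : End ℂ V) x, hTg j hj x⟩)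
        (fun w hw => ih (finrank ℂ (LinearMap.range T)) (by omega) (by omega) HH _ w hw le_rfl)
        (T x) ⟨x, rfl⟩)
    intro i hi
    ext x
    exact this x trivial i hi

lemma PP_all (m : ℕ) : ∀ d, 5 ≤ m → d + 3 ≤ m → (m < 8 → d + 4 ≤ m) → PP m d := by
  induction m using Nat.strong_induction_on with
  | _ m ih =>
  intro d hm hd hd'
  by_cases h5 : m = 5
  · intro V _ _ _ g hg hV
    exact PP_one m (by omega) V g hg (by omega)
  refine core_ab (by omega) d hd d le_rfl ?_
  intro V _ _ _ g hg hV
  by_cases h6 : m = 6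
  · subst h6
    by_cases htriv : Subsingleton V
    · left
      intro i _
      ext x
      exact Subsingleton.elim _ _
    have hnt : Nontrivial V := not_subsingleton_iff_nontrivial.1 htriv
    obtain ⟨y, hy⟩ := Module.End.exists_eigenvalue (g 0 : End ℂ V)
    have hy0 : y ≠ 0 := by
      rintro rfl
      obtain ⟨v, hv⟩ := hy.exists_hasEigenvector
      have h1 := hv.apply_eq_smul
      rw [zero_smul] at h1
      apply hv.2
      have := congrArg ((g 0)⁻¹ : (End ℂ V)ˣ).val h1
      rw [map_zero, ← Module.End.mul_apply, Units.inv_mul] at this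
      exact this
    right
    refine ⟨y, hy0, ?_⟩
    set T := (g 0 : End ℂ V) - algebraMap ℂ (End ℂ V) y with hT
    have hker : LinearMap.ker T ≠ ⊥ := by
      rw [Module.End.hasEigenvalue_iff, Module.End.eigenspace_def] at hy
      exact hy
    have hrk := LinearMap.finrank_range_add_finrank_ker T
    have hk1 : 0 < finrank ℂ (LinearMap.ker T) := by
      rw [Nat.pos_iff_ne_zero, Ne, Submodule.finrank_eq_zero]; exact hker
    have hg' : Br 4 (fun i => g (i + 2)) := by
      constructor
      · intro i j hij hj
        exact hg.comm (i + 2) (j + 2) (by omega) (by omega)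
      · intro i hi
        exact hg.braid (i + 2) (by omega)
    intro i hi
    ext x
    have hTc : ∀ i < 4 - 1, ∀ x, T ((g (i + 2) : End ℂ V) x) = (g (i + 2) : End ℂ V) (T x) := by
      intro i hi x
      have h0 : Commute (g 0 : End ℂ V) (g (i + 2) : End ℂ V) := by
        have := congrArg Units.val (hg.comm 0 (i + 2) (by omega) (by omega))
        exact this
      have h2 : Commute T (g (i + 2) : End ℂ V) := Commute.sub_left h0 (Algebra.commutes y _)
      exact congrArg (fun f : End ℂ V => f x) h2.eq
    have := hg'.ab_on (LinearMap.range T) (by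
        rintro j hj _ ⟨x, rfl⟩
        exact ⟨(g (j + 2) : End ℂ V) x, hTc j hj x⟩)
        (fun w hw => PP_one 4 (by omega) _ w hw (by omega)) (T x) ⟨x, rfl⟩ i (by omega)
    simp only [Module.End.mul_apply, LinearMap.sub_apply, LinearMap.zero_apply, sub_eq_zero]
    exact this
  · exact dichotomy (by omega) (ih (m - 2) (by omega) (d / 2) (by omega) (by omega) (by omega))
      (by omega) hg
end core

section fin
open Module
set_option linter.unusedSectionVars false
variable {V : Type} [AddCommGroup V] [Module ℂ V] [FiniteDimensional ℂ V]
variable {n : ℕ} {e : ℕ → (End ℂ V)ˣ} {δ : (End ℂ V)ˣ}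

lemma span_bound (hirr : ∀ p : Submodule ℂ V, (∀ i < n - 1, ∀ v ∈ p, (e i : End ℂ V) v ∈ p) →
      p = ⊥ ∨ p = ⊤) (k : ℕ) (hk : 0 < k) (w : ℕ → V) (hw : w 0 ≠ 0)
    (H : ∀ i < n - 1, ∀ j < k, (e i : End ℂ V) (w j) ∈
      Submodule.span ℂ (Set.range fun j : Fin k => w j)) : finrank ℂ V ≤ k := by
  have h1 := hirr (Submodule.span ℂ (Set.range fun j : Fin k => w j)) (by
    intro i hi v hv
    induction hv using Submodule.span_induction with
    | mem x hx => obtain ⟨j, rfl⟩ := hx; exact H i hi j j.2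
    | zero => simp
    | add x y _ _ hx hy => rw [map_add]; exact add_mem hx hy
    | smul a x _ hx => rw [map_smul]; exact Submodule.smul_mem _ _ hx)
  rcases h1 with h1 | h1
  · exfalso
    apply hw
    rw [Submodule.span_eq_bot] at h1
    exact h1 (w 0) ⟨⟨0, hk⟩, rfl⟩
  · have := finrank_range_le_card (R := ℂ) (fun j : Fin k => w j)
    rw [Set.finrank, h1, finrank_top, Fintype.card_fin] at this
    exact this

lemma exists_eig (f : End ℂ V) (W : Submodule ℂ V) (hW : W ≠ ⊥) (hf : ∀ x ∈ W, f x ∈ W) :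
    ∃ v ∈ W, v ≠ 0 ∧ ∃ c : ℂ, f v = c • v := by
  have : Nontrivial W := Submodule.nontrivial_iff_ne_bot.2 hW
  obtain ⟨c, hc⟩ := Module.End.exists_eigenvalue (f.restrict hf)
  obtain ⟨v, hv⟩ := hc.exists_hasEigenvector
  refine ⟨v, v.2, fun h => hv.2 (Subtype.ext h), c, ?_⟩
  have := congrArg (fun z : W => (z : V)) hv.apply_eq_smul
  simpa using this

/-- the Burau type case -/
lemma burau_case (h : Cyc n e δ) (hn : 6 ≤ n)
    (hirr : ∀ p : Submodule ℂ V, (∀ i < n - 1, ∀ v ∈ p, (e i : End ℂ V) v ∈ p) → p = ⊥ ∨ p = ⊤)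
    (H : ∀ i m, 2 ≤ m → m + 2 ≤ n → AA e (i + m) * AA e i = 0)
    (hA : AA e 0 ≠ 0) (hX : AA e 0 * e 0 + AA e 0 * AA e 1 * AA e 0 = 0) : finrank ℂ V ≤ n := by
  have hee : ∀ i x, (e i : End ℂ V) x = AA e i x + x := by
    intro i x; simp [AA]
  have hcomm : ∀ i x, (e i : End ℂ V) (AA e i x) = AA e i ((e i : End ℂ V) x) := by
    intro i x; simp [AA]
  have hX1 : ∀ i x, AA e i ((e i : End ℂ V) x) + AA e i (AA e (i + 1) (AA e i x)) = 0 := by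
    have : ∀ i, AA e i * e i + AA e i * AA e (i + 1) * AA e i = 0 := by
      intro i
      induction i with
      | zero => exact hX
      | succ i ih =>
        have c : (δ : End ℂ V) * (e i : End ℂ V) = (e (i + 1) : End ℂ V) * δ := by
          exact_mod_cast h.conj i
        have : (δ : End ℂ V) * (AA e i * e i + AA e i * AA e (i + 1) * AA e i) =
            (AA e (i + 1) * e (i + 1) + AA e (i + 1) * AA e (i + 1 + 1) * AA e (i + 1)) * δ := by
          rw [mul_add, ← mul_assoc, h.A_conj, mul_assoc, c, ← mul_assoc (δ : End ℂ V), h.A_conj2,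
            mul_assoc _ (δ : End ℂ V), h.A_conj, add_mul]
          simp only [mul_assoc]
        rw [ih, mul_zero] at this
        exact (Units.mul_left_eq_zero δ).1 this.symm
    intro i x
    exact congrArg (fun f : End ℂ V => f x) (this i)
  have hX2 : ∀ i x, AA e (i + 1) ((e (i + 1) : End ℂ V) x) +
      AA e (i + 1) (AA e i (AA e (i + 1) x)) = 0 := by
    intro i x
    have := congrArg (fun f : End ℂ V => f x) (h.A_braid i)
    simp only [LinearMap.add_apply, Module.End.mul_apply] at this
    rw [← this, hX1]
  obtain ⟨u, hu, hu0, s, hs⟩ := exists_eig (e 0 : End ℂ V) (LinearMap.range (AA e 0))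
    (by rwa [Ne, LinearMap.range_eq_bot]) (by
      rintro _ ⟨x, rfl⟩
      rw [hcomm]; exact ⟨_, rfl⟩)
  let w : ℕ → V := fun i => Nat.rec u (fun i x => AA e (i + 1) x) i
  have hw0 : w 0 = u := rfl
  have hws : ∀ i, w (i + 1) = AA e (i + 1) (w i) := fun i => rfl
  have hwr : ∀ i, ∃ x, w i = AA e i x := by
    intro i
    cases i with
    | zero => obtain ⟨x, hx⟩ := hu; exact ⟨x, hx.symm⟩
    | succ i => exact ⟨_, hws i⟩
  have ha : ∀ i, (e i : End ℂ V) (w i) = s • w i → AA e i (w (i + 1)) = - (s • w i) := by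
    intro i hi
    obtain ⟨x, hx⟩ := hwr i
    have := hX1 i x
    rw [← hcomm, ← hx, ← hws, hi] at this
    exact (neg_eq_of_add_eq_zero_right this).symm
  have hb : ∀ i, (e i : End ℂ V) (w i) = s • w i := by
    intro i
    induction i with
    | zero => exact hs
    | succ i ih =>
      have := hX2 i (w i)
      rw [← hws, ha i ih, map_neg, map_smul, ← hws, ← hcomm, ← hws, ← sub_eq_add_neg, sub_eq_zero] at this
      exact this
  refine (span_bound hirr (n - 1) (by omega) w hu0 ?_).trans (by omega)
  intro i hi j hj
  have hmem : ∀ j < n - 1, w j ∈ Submodule.span ℂ (Set.range fun j : Fin (n - 1) => w j) :=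
    fun j hj => Submodule.subset_span ⟨⟨j, hj⟩, rfl⟩
  rw [hee]
  refine add_mem ?_ (hmem j hj)
  obtain ⟨x, hx⟩ := hwr j
  rcases Nat.lt_trichotomy i j with hij | rfl | hij
  · by_cases h1 : j = i + 1
    · subst h1
      rw [ha i (hb i)]
      exact neg_mem (Submodule.smul_mem _ _ (hmem i hi))
    · have h2 := H i (j - i) (by omega) (by omega)
      have h3 := h.A_comm i (j - i) (by omega) (by omega)
      rw [h2, show i + (j - i) = j by omega] at h3
      rw [hx, ← Module.End.mul_apply, h3]
      exact zero_mem _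
  · have := hee i (w i)
    rw [hb i] at this
    rw [← sub_eq_iff_eq_add.2 this]
    exact sub_mem (Submodule.smul_mem _ _ (hmem i hi)) (hmem i hi)
  · by_cases h1 : i = j + 1
    · subst h1
      rw [← hws]
      exact hmem _ hi
    · have h2 := H j (i - j) (by omega) (by omega)
      rw [show j + (i - j) = i by omega] at h2
      rw [hx, ← Module.End.mul_apply, h2]
      exact zero_mem _

/-- the standard representation -/
lemma standard_case (h : Cyc n e δ) (hn : 6 ≤ n)
    (hirr : ∀ p : Submodule ℂ V, (∀ i < n - 1, ∀ v ∈ p, (e i : End ℂ V) v ∈ p) → p = ⊥ ∨ p = ⊤)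
    (v : V) (hv : v ≠ 0) (t : ℂ) (ht : (e 0 : End ℂ V) ((e 0 : End ℂ V) v) = t • v)
    (hfix : ∀ j, 1 ≤ j → j < n - 1 → (e j : End ℂ V) v = v) : finrank ℂ V ≤ n := by
  have hc : ∀ i j x, i + 2 ≤ j → j < n - 1 → (e i : End ℂ V) ((e j : End ℂ V) x) =
      (e j : End ℂ V) ((e i : End ℂ V) x) := by
    intro i j x hij hj
    have := h.comm i (j - i) (by omega) (by omega)
    rw [show i + (j - i) = j by omega] at this
    exact congrArg (fun f : (End ℂ V)ˣ => (f : End ℂ V) x) this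
  have hbr : ∀ i x, (e i : End ℂ V) ((e (i + 1) : End ℂ V) ((e i : End ℂ V) x)) =
      (e (i + 1) : End ℂ V) ((e i : End ℂ V) ((e (i + 1) : End ℂ V) x)) := by
    intro i x
    exact congrArg (fun f : (End ℂ V)ˣ => (f : End ℂ V) x) (h.braid i)
  let w : ℕ → V := fun i => Nat.rec v (fun i x => (e i : End ℂ V) x) i
  have hw0 : w 0 = v := rfl
  have hws : ∀ i, w (i + 1) = (e i : End ℂ V) (w i) := fun i => rfl
  have hF : ∀ i j, i < j → j < n - 1 → (e j : End ℂ V) (w i) = w i := by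
    intro i
    induction i with
    | zero => intro j h1 h2; exact hfix j h1 h2
    | succ i ih =>
      intro j h1 h2
      rw [hws, ← hc i j _ (by omega) h2, ih j (by omega) h2]
  have hG : ∀ i, i < n - 1 → (e i : End ℂ V) ((e i : End ℂ V) (w i)) = t • w i := by
    intro i
    induction i with
    | zero => intro _; exact ht
    | succ i ih =>
      intro hi
      have hf := hF i (i + 1) (by omega) hi
      calc (e (i + 1) : End ℂ V) ((e (i + 1) : End ℂ V) (w (i + 1)))
          = (e (i + 1) : End ℂ V) ((e (i + 1) : End ℂ V) ((e i : End ℂ V) ((e (i + 1) : End ℂ V) (w i)))) := by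
            rw [hf, hws]
        _ = (e i : End ℂ V) ((e (i + 1) : End ℂ V) ((e i : End ℂ V) ((e i : End ℂ V) (w i)))) := by
            rw [← hbr, ← hbr]
        _ = t • w (i + 1) := by rw [ih (by omega), map_smul, hf, map_smul, hws]
  have hB : ∀ i j, i + 2 ≤ j → j < n → (e i : End ℂ V) (w j) = w j := by
    intro i j hij
    induction j, hij using Nat.le_induction with
    | base =>
      intro hj
      rw [show i + 2 = i + 1 + 1 by rfl, hws, hws, hbr, hF i (i + 1) (by omega) (by omega)]
    | succ j hij ih =>
      intro hj
      rw [hws, hc i j _ hij (by omega), ih (by omega)]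
  refine span_bound hirr n (by omega) w hv ?_
  intro i hi j hj
  have hmem : ∀ j < n, w j ∈ Submodule.span ℂ (Set.range fun j : Fin n => w j) :=
    fun j hj => Submodule.subset_span ⟨⟨j, hj⟩, rfl⟩
  rcases Nat.lt_trichotomy i j with hij | rfl | hij
  · by_cases h1 : j = i + 1
    · subst h1
      rw [hws, hG i hi]
      exact Submodule.smul_mem _ _ (hmem i (by omega))
    · rw [hB i j (by omega) hj]
      exact hmem j hj
  · rw [← hws]; exact hmem (i + 1) (by omega)
  · rw [hF j i hij hi]; exact hmem j hj

lemma main_case (h : Cyc n e δ) (hn : 6 ≤ n)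
    (hirr : ∀ p : Submodule ℂ V, (∀ i < n - 1, ∀ v ∈ p, (e i : End ℂ V) v ∈ p) → p = ⊥ ∨ p = ⊤)
    (H : ∀ i m, 2 ≤ m → m + 2 ≤ n → AA e (i + m) * AA e i = 0)
    (hA : AA e 0 ≠ 0) : finrank ℂ V ≤ n := by
  set X := AA e 0 * e 0 + AA e 0 * AA e 1 * AA e 0 with hXdef
  by_cases hX : X = 0
  · exact burau_case h hn hirr H hA hX
  have hX' : X = AA e 1 * e 1 + AA e 1 * AA e 0 * AA e 1 := h.A_braid 0
  have hkill : ∀ j, 2 ≤ j → j < n → AA e j * X = 0 := by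
    intro j h2 hj
    by_cases hj2 : j = 2
    · have := H 0 2 (by omega) (by omega)
      rw [zero_add] at this
      rw [hj2, hXdef, mul_add, ← mul_assoc, this, ← mul_assoc, ← mul_assoc, this]
      simp
    · have := H 1 (j - 1) (by omega) (by omega)
      rw [show 1 + (j - 1) = j by omega] at this
      rw [hX', mul_add, ← mul_assoc, this, ← mul_assoc, ← mul_assoc, this]
      simp
  have hfixZ : ∀ j, 2 ≤ j → j < n → ∀ z ∈ LinearMap.range X, (e j : End ℂ V) z = z := by
    rintro j h2 hj _ ⟨x, rfl⟩
    have := congrArg (fun f : End ℂ V => f x) (hkill j h2 hj)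
    simp only [AA, Module.End.mul_apply, LinearMap.sub_apply, Module.End.one_apply,
      LinearMap.zero_apply, sub_eq_zero] at this
    exact this
  -- `e 1` fixes `(e 0)⁻¹ z`
  have hfix1 : ∀ z, (e 0 : End ℂ V) z ∈ LinearMap.range X → (e 1 : End ℂ V) z = z := by
    intro z hz
    have hδ : δ = pr (fun j => e (2 + j)) (n - 2) * e 0 := by
      have := h.prod 2
      change δ = pr (fun j => e (2 + j)) (n - 1) at this
      rw [show n - 1 = n - 2 + 1 by omega, pr_succ, show 2 + (n - 2) = 0 + n by omega, h.per] at this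
      exact this
    have hp : ∀ k ≤ n - 2, ∀ y ∈ LinearMap.range X, ((pr (fun j => e (2 + j)) k : (End ℂ V)ˣ) : End ℂ V) y = y := by
      intro k
      induction k with
      | zero => intro _ y _; simp [pr]
      | succ k ih =>
        intro hk y hy
        rw [pr_succ, Units.val_mul, Module.End.mul_apply, hfixZ (2 + k) (by omega) (by omega) y hy,
          ih (by omega) y hy]
    have h1 : (δ : End ℂ V) z = (e 0 : End ℂ V) z := by
      rw [hδ, Units.val_mul, Module.End.mul_apply, hp _ le_rfl _ hz]
    have h2 := congrArg (fun f : (End ℂ V)ˣ => (f : End ℂ V) z) (h.conj 1)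
    simp only [Units.val_mul, Module.End.mul_apply] at h2
    rw [h1, hfixZ (1 + 1) (by omega) (by omega) _ hz, ← h1] at h2
    have h3 := congrArg ((δ⁻¹ : (End ℂ V)ˣ) : End ℂ V) h2
    simpa only [← Module.End.mul_apply, Units.inv_mul_cancel_left, Units.inv_mul, Module.End.one_apply] using h3
  have hbr : (e 0 : End ℂ V) * (e 1 : End ℂ V) * (e 0 : End ℂ V)
      = (e 1 : End ℂ V) * (e 0 : End ℂ V) * (e 1 : End ℂ V) := by
    exact_mod_cast h.braid 0
  set D := (e 0 : End ℂ V) * (e 1 : End ℂ V) * (e 0 : End ℂ V) with hD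
  have hDe0 : D * e 0 = e 1 * D := by
    conv_lhs => rw [hbr]
    rw [hD]; simp only [mul_assoc]
  have hDe1 : D * e 1 = e 0 * D := by
    conv_rhs => rw [hbr]
    rw [hD]; simp only [mul_assoc]
  have hDA0 : D * AA e 0 = AA e 1 * D := by simp only [AA, mul_sub, sub_mul, hDe0, mul_one, one_mul]
  have hDA1 : D * AA e 1 = AA e 0 * D := by simp only [AA, mul_sub, sub_mul, hDe1, mul_one, one_mul]
  have hDX : D * X = X * D := by
    conv_rhs => rw [hX']
    rw [hXdef, mul_add, add_mul]
    congr 1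
    · rw [← mul_assoc, hDA0, mul_assoc, hDe0, mul_assoc]
    · rw [← mul_assoc, ← mul_assoc, hDA0, mul_assoc (AA e 1), hDA1, mul_assoc, mul_assoc (AA e 0), hDA0]
      simp only [mul_assoc]
  have hDZ : ∀ z ∈ LinearMap.range X, D z ∈ LinearMap.range X := by
    rintro _ ⟨x, rfl⟩
    exact ⟨D x, (congrArg (fun f : End ℂ V => f x) hDX).symm⟩
  have hZ1 : ∀ z ∈ LinearMap.range X, (e 1 : End ℂ V) ((e 0 : End ℂ V) z) = (e 0 : End ℂ V) z := by
    intro z hz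
    have h1 := hfix1 ((e 1 : End ℂ V) ((e 0 : End ℂ V) z)) (hDZ z hz)
    have h3 := congrArg (((e 1)⁻¹ : (End ℂ V)ˣ) : End ℂ V) h1
    simpa only [← Module.End.mul_apply, Units.inv_mul_cancel_left] using h3
  obtain ⟨z, hz, hz0, t, ht⟩ := exists_eig ((e 0 : End ℂ V) * (e 0 : End ℂ V)) (LinearMap.range X)
    (by rwa [Ne, LinearMap.range_eq_bot]) (by
      intro z hz
      have := hDZ z hz
      rw [hD, Module.End.mul_apply, Module.End.mul_apply, hZ1 z hz] at this
      exact this)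
  obtain ⟨v, rfl⟩ : ∃ v, (e 0 : End ℂ V) v = z :=
    ⟨(((e 0)⁻¹ : (End ℂ V)ˣ) : End ℂ V) z, by rw [← Module.End.mul_apply, Units.mul_inv]; rfl⟩
  have hinj : Function.Injective (e 0 : End ℂ V) := by
    rw [← LinearMap.ker_eq_bot, ← LinearMap.isUnit_iff_ker_eq_bot]
    exact (e 0).isUnit
  refine standard_case h hn hirr v ?_ t ?_ ?_
  · rintro rfl; exact hz0 (map_zero _)
  · apply hinj
    rw [map_smul, ← ht]; rfl
  · intro j h1 hj
    by_cases hj1 : j = 1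
    · subst hj1; exact hfix1 v hz
    · apply hinj
      have hcm := h.comm 0 j (by omega) (by omega)
      rw [zero_add] at hcm
      have h5 := congrArg (fun f : (End ℂ V)ˣ => (f : End ℂ V) v) hcm
      simp only [Units.val_mul, Module.End.mul_apply] at h5
      rw [h5]
      exact hfixZ j (by omega) (by omega) _ hz

lemma no_rep {n : ℕ} (hn : 10 ≤ n) (hr₁ : n + 1 ≤ finrank ℂ V) (hr₂ : finrank ℂ V ≤ 2 * n - 9)
    (g : ℕ → (End ℂ V)ˣ) (hg : Br n g)
    (hirr : ∀ p : Submodule ℂ V, (∀ i < n - 1, ∀ v ∈ p, (g i : End ℂ V) v ∈ p) → p = ⊥ ∨ p = ⊤) :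
    False := by
  have hnt : Nontrivial V := Module.nontrivial_of_finrank_pos (R := ℂ) (by omega)
  have hnab : ¬ AllEq n g := by
    intro hab
    obtain ⟨v, _, hv0, c, hc⟩ := exists_eig (g 0 : End ℂ V) ⊤ top_ne_bot (fun _ _ => trivial)
    have := span_bound (e := g) hirr 1 (by omega) (fun _ => v) hv0 (by
      intro i hi j hj
      rw [hab i hi, hc]
      exact Submodule.smul_mem _ _ (Submodule.subset_span ⟨0, rfl⟩))
    omega
  rcases dichotomy (n := n) (d := n - 5) (by omega)
    (PP_all (n - 2) (n - 5) (by omega) (by omega) (by omega)) (by omega) hg with h | ⟨y, hy, H⟩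
  · exact hnab h
  obtain ⟨e, δ, he, hge, N, hN1, hN2⟩ := hg.scale y hy (by omega) H
  have hirr' : ∀ p : Submodule ℂ V, (∀ i < n - 1, ∀ v ∈ p, (e i : End ℂ V) v ∈ p) →
      p = ⊥ ∨ p = ⊤ := by
    intro p hp
    apply hirr
    intro i hi v hv
    rw [hge i hi]
    exact Submodule.smul_mem _ _ (hp i hi v hv)
  obtain ⟨c, hc⟩ := Module.End.exists_eigenvalue N
  have hker : LinearMap.ker (N - algebraMap ℂ (End ℂ V) c) ≠ ⊥ := by
    rw [Module.End.hasEigenvalue_iff, Module.End.eigenspace_def] at hc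
    exact hc
  have htop := (hirr' (LinearMap.ker (N - algebraMap ℂ (End ℂ V) c)) (by
    intro i hi x hx
    have h1 : Commute N (e i : End ℂ V) := hN1 i
    have h2 : Commute (N - algebraMap ℂ (End ℂ V) c) (e i : End ℂ V) :=
      Commute.sub_left h1 (Algebra.commutes c _)
    have := congrArg (fun f : End ℂ V => f x) h2.eq
    simp only [Module.End.mul_apply] at this
    rw [LinearMap.mem_ker] at *
    rw [this, hx, map_zero])).resolve_left hker
  rw [LinearMap.ker_eq_top, sub_eq_zero] at htop
  subst htop
  rcases he.N_scalar (by omega) c hN2 with h0 | h0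
  · subst h0
    rw [map_zero] at hN2
    have := main_case he (by omega) hirr' hN2 (by
      intro h0
      have h1 := he.A_conj 0
      rw [h0, mul_zero] at h1
      have h2 := (Units.mul_left_eq_zero δ).1 h1.symm
      refine hnab (allEq_of_scale (by omega) he y hge 0 (Units.ext ?_))
      simp only [AA, sub_eq_zero] at h0 h2
      rw [h0, h2])
    omega
  · exact hnab (allEq_of_scale (by omega) he y hge 2 h0)
end fin

/-- (Reduction Theorem) For `n ≥ 10`, every irreducible representation of `B_n` of
dimension `r` with `n+1 ≤ r ≤ 2n-9` is a tensor product of a one-dimensional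
representation `χ(y)` and an irreducible representation of dimension `r` and corank
`k` with `3 ≤ k ≤ r - n + 2`. -/
theorem stmt_3 (n r : ℕ) (hn : 10 ≤ n) (hr₁ : n + 1 ≤ r) (hr₂ : r ≤ 2 * n - 9)
    (C : ℕ → Matrix (Fin r) (Fin r) ℂ)
    (hinv : ∀ i, 1 ≤ i → i ≤ n - 1 → IsUnit (C i))
    (hcomm : ∀ i j, 1 ≤ i → i ≤ n - 1 → 1 ≤ j → j ≤ n - 1 → i + 2 ≤ j →
      C i * C j = C j * C i)
    (hbraid : ∀ i, 1 ≤ i → i ≤ n - 2 →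
      C i * C (i + 1) * C i = C (i + 1) * C i * C (i + 1))
    (hirr : ∀ p : Submodule ℂ (Fin r → ℂ),
      (∀ i, 1 ≤ i → i ≤ n - 1 → ∀ v ∈ p, (C i).mulVec v ∈ p) → p = ⊥ ∨ p = ⊤) :
    ∃ (y : ℂ) (k : ℕ) (D : ℕ → Matrix (Fin r) (Fin r) ℂ), y ≠ 0 ∧
      3 ≤ k ∧ k ≤ r - n + 2 ∧
      (∀ i, 1 ≤ i → i ≤ n - 1 → IsUnit (D i)) ∧
      (∀ i j, 1 ≤ i → i ≤ n - 1 → 1 ≤ j → j ≤ n - 1 → i + 2 ≤ j →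
        D i * D j = D j * D i) ∧
      (∀ i, 1 ≤ i → i ≤ n - 2 →
        D i * D (i + 1) * D i = D (i + 1) * D i * D (i + 1)) ∧
      (∀ p : Submodule ℂ (Fin r → ℂ),
        (∀ i, 1 ≤ i → i ≤ n - 1 → ∀ v ∈ p, (D i).mulVec v ∈ p) → p = ⊥ ∨ p = ⊤) ∧
      (D 1 - 1).rank = k ∧
      (∀ i, 1 ≤ i → i ≤ n - 1 → C i = y • D i) := by
  exfalso
  have hu : ∀ i, ∃ u : (Module.End ℂ (Fin r → ℂ))ˣ, i < n - 1 →
      (u : Module.End ℂ (Fin r → ℂ)) = Matrix.toLin' (C (i + 1)) := by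
    intro i
    by_cases hi : i < n - 1
    · have h1 := (hinv (i + 1) (by omega) (by omega)).map
        (Matrix.toLinAlgEquiv' : Matrix (Fin r) (Fin r) ℂ ≃ₐ[ℂ] _)
      exact ⟨h1.unit, fun _ => rfl⟩
    · exact ⟨1, fun h => absurd h hi⟩
  choose g hg using hu
  refine no_rep (V := Fin r → ℂ) hn (by simpa using hr₁) (by simpa using hr₂) g ⟨?_, ?_⟩ ?_
  · intro i j hij hj
    ext1
    rw [Units.val_mul, Units.val_mul, hg i (by omega), hg j (by omega), Module.End.mul_eq_comp,
      Module.End.mul_eq_comp, ← Matrix.toLin'_mul, ← Matrix.toLin'_mul,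
      hcomm (i + 1) (j + 1) (by omega) (by omega) (by omega) (by omega) (by omega)]
  · intro i hi
    ext1
    simp only [Units.val_mul, hg i (by omega), hg (i + 1) (by omega), Module.End.mul_eq_comp,
      ← Matrix.toLin'_mul]
    rw [hbraid (i + 1) (by omega) (by omega)]
  · intro p hp
    apply hirr
    intro i h1 h2 v hv
    have := hp (i - 1) (by omega) v hv
    rw [hg (i - 1) (by omega), show i - 1 + 1 = i by omega, Matrix.toLin'_apply] at this
    exact this
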